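/- Let T be a Leibniz triple system over a field K of characteristic 0 and let I and J be ideals of T. Then for every n ≥ 1, (I + J)^n ⊆ I^n + J^n + Σ_{k=0}^{n−1} (I^k ∩ J^{n−1−k}), where for an ideal A the central lower sequence is A^0 = A and A^{m+1} = {A^m A T} + {A^m T A} + {A A^m T} + {A T A^m} + {T A A^m} + {T A^m A}. -/

import Mathlib

open TensorProduct

noncomputable section

variable {K : Type*} [Field K] [CharZero K]
variable {T : Type*} [AddCommGroup T] [Module K T]

/-- First defining identity of a Leibniz triple system:
`{a{bcd}e} = {{abc}de} − {{acb}de} − {{adb}ce} + {{adc}be}`. -/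
def LTS1 (t : T →ₗ[K] T →ₗ[K] T →ₗ[K] T) : Prop :=
  ∀ a b c d e : T,
    t a (t b c d) e =
      t (t a b c) d e - t (t a c b) d e - t (t a d b) c e + t (t a d c) b e

/-- Second defining identity of a Leibniz triple system:
`{ab{cde}} = {{abc}de} − {{abd}ce} − {{abe}cd} + {{abe}dc}`. -/
def LTS2 (t : T →ₗ[K] T →ₗ[K] T →ₗ[K] T) : Prop :=
  ∀ a b c d e : T,
    t a b (t c d e) =
      t (t a b c) d e - t (t a b d) c e - t (t a b e) c d + t (t a b e) d c

/-- The axioms of a Lie triple system. -/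
def IsLieTS (t : T →ₗ[K] T →ₗ[K] T →ₗ[K] T) : Prop :=
  (∀ a c : T, t a a c = 0) ∧
  (∀ a b c : T, t a b c + t b c a + t c a b = 0) ∧
  (∀ a b c d e : T,
    t a b (t c d e) = t (t a b c) d e + t c (t a b d) e + t c d (t a b e))

/-- The bracket of the universal Leibniz envelope `U(T) = T ⊕ (T ⊗ T)`,
determined by `[a,b] = a⊗b`, `[a⊗b,c] = {abc}`, `[a,b⊗c] = {abc} − {acb}`,
`[a⊗b,c⊗d] = {abc}⊗d − {abd}⊗c`. -/
def bkt (t : T →ₗ[K] T →ₗ[K] T →ₗ[K] T) (x y : T × (T ⊗[K] T)) :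
    T × (T ⊗[K] T) :=
  (TensorProduct.lift t x.2 y.1
      + TensorProduct.lift (t x.1) y.2 - TensorProduct.lift ((t x.1).flip) y.2,
   x.1 ⊗ₜ[K] y.1
      + LinearMap.rTensor T (TensorProduct.lift t x.2) y.2
      - LinearMap.rTensor T (TensorProduct.lift t x.2) (TensorProduct.comm K T T y.2))

/-- The induced bracket on the subalgebra `T ⊗ T` of `U(T)`. -/
def bktT (t : T →ₗ[K] T →ₗ[K] T →ₗ[K] T) (w w' : T ⊗[K] T) : T ⊗[K] T :=
  LinearMap.rTensor T (TensorProduct.lift t w) w'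
    - LinearMap.rTensor T (TensorProduct.lift t w) (TensorProduct.comm K T T w')

/-- `{ABC}`: the span of all products `{abc}` with `a ∈ A`, `b ∈ B`, `c ∈ C`. -/
def tspan (t : T →ₗ[K] T →ₗ[K] T →ₗ[K] T) (A B C : Submodule K T) : Submodule K T :=
  Submodule.span K {x | ∃ a ∈ A, ∃ b ∈ B, ∃ c ∈ C, x = t a b c}

/-- `I` is an ideal of the Leibniz triple system `(T, t)`. -/
def IsIdealT (t : T →ₗ[K] T →ₗ[K] T →ₗ[K] T) (I : Submodule K T) : Prop :=
  ∀ x ∈ I, ∀ a b : T, t x a b ∈ I ∧ t a x b ∈ I ∧ t a b x ∈ I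

/-- `i(I) = I ⊗ T + T ⊗ I` as a subspace of `T ⊗ T`. -/
def iI (I : Submodule K T) : Submodule K (T ⊗[K] T) :=
  Submodule.span K
    {z | (∃ x ∈ I, ∃ a : T, z = x ⊗ₜ[K] a) ∨ (∃ x ∈ I, ∃ a : T, z = a ⊗ₜ[K] x)}

/-- `j(I) = {w ∈ T⊗T | [w, T] + [T, w] ⊆ I}`. -/
def jI (t : T →ₗ[K] T →ₗ[K] T →ₗ[K] T) (I : Submodule K T) : Submodule K (T ⊗[K] T) :=
  ⨅ a : T,
    Submodule.comap ((TensorProduct.lift t).flip a) I ⊓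
      Submodule.comap (TensorProduct.lift (t a) - TensorProduct.lift ((t a).flip)) I

/-- `𝕀(I) = I + i(I)` as a subspace of `U(T)`. -/
def IU (I : Submodule K T) : Submodule K (T × (T ⊗[K] T)) := I.prod (iI I)

/-- `𝕁(I) = I + j(I)` as a subspace of `U(T)`. -/
def JU (t : T →ₗ[K] T →ₗ[K] T →ₗ[K] T) (I : Submodule K T) :
    Submodule K (T × (T ⊗[K] T)) := I.prod (jI t I)

/-- `V` is an ideal of the Leibniz algebra `T ⊗ T`. -/
def IsIdealTT (t : T →ₗ[K] T →ₗ[K] T →ₗ[K] T) (V : Submodule K (T ⊗[K] T)) : Prop :=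
  ∀ v ∈ V, ∀ w : T ⊗[K] T, bktT t v w ∈ V ∧ bktT t w v ∈ V

/-- `V` is an ideal of the Leibniz algebra `U(T)`. -/
def IsIdealU (t : T →ₗ[K] T →ₗ[K] T →ₗ[K] T) (V : Submodule K (T × (T ⊗[K] T))) : Prop :=
  ∀ v ∈ V, ∀ x : T × (T ⊗[K] T), bkt t v x ∈ V ∧ bkt t x v ∈ V

/-- The derived series of `I` relative to an ambient subsystem `S`:
`I⁰ = I`, `Iⁿ⁺¹ = {S Iⁿ Iⁿ} + {Iⁿ S Iⁿ} + {Iⁿ Iⁿ S}`. -/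
def derRel (t : T →ₗ[K] T →ₗ[K] T →ₗ[K] T) (S I : Submodule K T) : ℕ → Submodule K T
  | 0 => I
  | n + 1 =>
      tspan t S (derRel t S I n) (derRel t S I n) ⊔
        tspan t (derRel t S I n) S (derRel t S I n) ⊔
          tspan t (derRel t S I n) (derRel t S I n) S

/-- The derived series `I^[n]` of an ideal `I` of `T`:
`I^[0] = I`, `I^[n+1] = {T I^[n] I^[n]} + {I^[n] T I^[n]} + {I^[n] I^[n] T}`. -/
def derT (t : T →ₗ[K] T →ₗ[K] T →ₗ[K] T) (I : Submodule K T) : ℕ → Submodule K T :=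
  derRel t ⊤ I

/-- `I` is a solvable ideal of the Leibniz triple system `T`. -/
def IsSolvT (t : T →ₗ[K] T →ₗ[K] T →ₗ[K] T) (I : Submodule K T) : Prop :=
  ∃ k, derT t I k = ⊥

/-- The span of all brackets `[x, y]`, `x ∈ A`, `y ∈ B`, in `U(T)`. -/
def bspan (t : T →ₗ[K] T →ₗ[K] T →ₗ[K] T) (A B : Submodule K (T × (T ⊗[K] T))) :
    Submodule K (T × (T ⊗[K] T)) :=
  Submodule.span K {z | ∃ x ∈ A, ∃ y ∈ B, z = bkt t x y}

/-- The derived series of a subspace `V` of the Leibniz algebra `U(T)`. -/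
def derU (t : T →ₗ[K] T →ₗ[K] T →ₗ[K] T) (V : Submodule K (T × (T ⊗[K] T))) :
    ℕ → Submodule K (T × (T ⊗[K] T))
  | 0 => V
  | n + 1 => bspan t (derU t V n) (derU t V n)

/-- `V` is a solvable subspace of the Leibniz algebra `U(T)`. -/
def IsSolvU (t : T →ₗ[K] T →ₗ[K] T →ₗ[K] T) (V : Submodule K (T × (T ⊗[K] T))) : Prop :=
  ∃ k, derU t V k = ⊥

/-- The solvable radical `R(T)`: the sum of all solvable ideals of `T`. -/
def radT (t : T →ₗ[K] T →ₗ[K] T →ₗ[K] T) : Submodule K T :=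
  sSup {S : Submodule K T | IsIdealT t S ∧ IsSolvT t S}

/-- The solvable radical `Rad(U(T))`: the sum of all solvable ideals of `U(T)`. -/
def radU (t : T →ₗ[K] T →ₗ[K] T →ₗ[K] T) : Submodule K (T × (T ⊗[K] T)) :=
  sSup {V : Submodule K (T × (T ⊗[K] T)) | IsIdealU t V ∧ IsSolvU t V}

/-- `Ker(T)`: the span of all `{abc} − {acb} + {bca}`. -/
def kerT (t : T →ₗ[K] T →ₗ[K] T →ₗ[K] T) : Submodule K T :=
  Submodule.span K {x | ∃ a b c : T, x = t a b c - t a c b + t b c a}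

/-- `Ker(U(T))`: the span of all `[x, x]`, `x ∈ U(T)`. -/
def kerU (t : T →ₗ[K] T →ₗ[K] T →ₗ[K] T) : Submodule K (T × (T ⊗[K] T)) :=
  Submodule.span K {z | ∃ x : T × (T ⊗[K] T), z = bkt t x x}

/-- The central lower sequence of an ideal `I` of `T`: `I⁰ = I`,
`Iᵐ⁺¹ = {Iᵐ I T} + {Iᵐ T I} + {I Iᵐ T} + {I T Iᵐ} + {T I Iᵐ} + {T Iᵐ I}`. -/
def clsT (t : T →ₗ[K] T →ₗ[K] T →ₗ[K] T) (I : Submodule K T) : ℕ → Submodule K T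
  | 0 => I
  | m + 1 =>
      tspan t (clsT t I m) I ⊤ ⊔ tspan t (clsT t I m) ⊤ I ⊔
        tspan t I (clsT t I m) ⊤ ⊔ tspan t I ⊤ (clsT t I m) ⊔
          tspan t ⊤ I (clsT t I m) ⊔ tspan t ⊤ (clsT t I m) I

/-- `I` is a nilpotent ideal of the Leibniz triple system `T`. -/
def IsNilT (t : T →ₗ[K] T →ₗ[K] T →ₗ[K] T) (I : Submodule K T) : Prop :=
  ∃ n, clsT t I n = ⊥

/-- The lower central series of a subspace `V` of the Leibniz algebra `U(T)`:
`V⁰ = V`, `Vᵐ⁺¹ = [Vᵐ, V]`. -/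
def clsU (t : T →ₗ[K] T →ₗ[K] T →ₗ[K] T) (V : Submodule K (T × (T ⊗[K] T))) :
    ℕ → Submodule K (T × (T ⊗[K] T))
  | 0 => V
  | m + 1 => bspan t (clsU t V m) V

/-- `V` is a nilpotent subspace of the Leibniz algebra `U(T)`. -/
def IsNilU (t : T →ₗ[K] T →ₗ[K] T →ₗ[K] T) (V : Submodule K (T × (T ⊗[K] T))) : Prop :=
  ∃ n, clsU t V n = ⊥

/-- `Tⁿ`: the lower central series of `T`, `T⁰ = T`,
`Tⁿ⁺¹ = {Tⁿ T T} + {T Tⁿ T} + {T T Tⁿ}`. -/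
def lcsT (t : T →ₗ[K] T →ₗ[K] T →ₗ[K] T) : ℕ → Submodule K T
  | 0 => ⊤
  | n + 1 => tspan t (lcsT t n) ⊤ ⊤ ⊔ tspan t ⊤ (lcsT t n) ⊤ ⊔ tspan t ⊤ ⊤ (lcsT t n)

/-- `T⁽ⁿ⁾`: `T⁽⁰⁾ = T`, `T⁽ⁿ⁺¹⁾ = {T⁽ⁿ⁾ T T}`. -/
def powT (t : T →ₗ[K] T →ₗ[K] T →ₗ[K] T) : ℕ → Submodule K T
  | 0 => ⊤
  | n + 1 => tspan t (powT t n) ⊤ ⊤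


/-- The span of all products of an element of `A`, an element of `B` and an element of `T`, in any
order. -/
def mixedProd (t : T →ₗ[K] T →ₗ[K] T →ₗ[K] T) (A B : Submodule K T) : Submodule K T :=
  tspan t A B ⊤ ⊔ tspan t A ⊤ B ⊔ tspan t B A ⊤ ⊔ tspan t B ⊤ A ⊔ tspan t ⊤ B A ⊔ tspan t ⊤ A B

/-- All six products of `a`, `b`, `c` lie in `P`. -/
def AllProdMem (t : T →ₗ[K] T →ₗ[K] T →ₗ[K] T) (P : Submodule K T) (a b c : T) : Prop :=
  t a b c ∈ P ∧ t a c b ∈ P ∧ t b a c ∈ P ∧ t b c a ∈ P ∧ t c b a ∈ P ∧ t c a b ∈ P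

theorem tspan_le {t : T →ₗ[K] T →ₗ[K] T →ₗ[K] T} {A B C P : Submodule K T} :
    tspan t A B C ≤ P ↔ ∀ a ∈ A, ∀ b ∈ B, ∀ c ∈ C, t a b c ∈ P := by
  rw [tspan, Submodule.span_le]
  constructor
  · intro h a ha b hb c hc
    exact h ⟨a, ha, b, hb, c, hc, rfl⟩
  · rintro h _ ⟨a, ha, b, hb, c, hc, rfl⟩
    exact h a ha b hb c hc

theorem mixedProd_le {t : T →ₗ[K] T →ₗ[K] T →ₗ[K] T} {A B P : Submodule K T} :
    mixedProd t A B ≤ P ↔ ∀ a ∈ A, ∀ b ∈ B, ∀ c, AllProdMem t P a b c := by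
  simp only [mixedProd, sup_le_iff, tspan_le, Submodule.mem_top, true_imp_iff, AllProdMem]
  constructor
  · rintro ⟨⟨⟨⟨⟨h₁, h₂⟩, h₃⟩, h₄⟩, h₅⟩, h₆⟩ a ha b hb c
    exact ⟨h₁ a ha b hb c, h₂ a ha c b hb, h₃ b hb a ha c, h₄ b hb c a ha, h₅ c b hb a ha,
      h₆ c a ha b hb⟩
  · intro h
    exact ⟨⟨⟨⟨⟨fun a ha b hb c => (h a ha b hb c).1, fun a ha c b hb => (h a ha b hb c).2.1⟩,
      fun b hb a ha c => (h a ha b hb c).2.2.1⟩, fun b hb c a ha => (h a ha b hb c).2.2.2.1⟩,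
      fun c b hb a ha => (h a ha b hb c).2.2.2.2.1⟩, fun c a ha b hb => (h a ha b hb c).2.2.2.2.2⟩

theorem allProdMem_mixedProd (t : T →ₗ[K] T →ₗ[K] T →ₗ[K] T) {A B : Submodule K T} {a b : T}
    (ha : a ∈ A) (hb : b ∈ B) (c : T) : AllProdMem t (mixedProd t A B) a b c :=
  mixedProd_le.1 le_rfl a ha b hb c

theorem mixedProd_comm (t : T →ₗ[K] T →ₗ[K] T →ₗ[K] T) (A B : Submodule K T) :
    mixedProd t A B = mixedProd t B A := by
  simp only [mixedProd]
  ac_rfl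

/-- The elements whose products with `B` and `T`, in any order, lie in `P`. -/
def mixedResidual (t : T →ₗ[K] T →ₗ[K] T →ₗ[K] T) (P B : Submodule K T) : Submodule K T where
  carrier := {a | ∀ b ∈ B, ∀ c, AllProdMem t P a b c}
  zero_mem' := by simp [AllProdMem]
  add_mem' := by
    intro x y hx hy b hb c
    obtain ⟨x₁, x₂, x₃, x₄, x₅, x₆⟩ := hx b hb c
    obtain ⟨y₁, y₂, y₃, y₄, y₅, y₆⟩ := hy b hb c
    simp only [AllProdMem, map_add, LinearMap.add_apply]
    exact ⟨P.add_mem x₁ y₁, P.add_mem x₂ y₂, P.add_mem x₃ y₃, P.add_mem x₄ y₄, P.add_mem x₅ y₅,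
      P.add_mem x₆ y₆⟩
  smul_mem' := by
    intro r x hx b hb c
    obtain ⟨x₁, x₂, x₃, x₄, x₅, x₆⟩ := hx b hb c
    simp only [AllProdMem, map_smul, LinearMap.smul_apply]
    exact ⟨P.smul_mem r x₁, P.smul_mem r x₂, P.smul_mem r x₃, P.smul_mem r x₄, P.smul_mem r x₅,
      P.smul_mem r x₆⟩

theorem mixedProd_le_iff_le_residual {t : T →ₗ[K] T →ₗ[K] T →ₗ[K] T} {A B P : Submodule K T} :
    mixedProd t A B ≤ P ↔ A ≤ mixedResidual t P B :=
  mixedProd_le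

theorem mixedProd_sup_le {t : T →ₗ[K] T →ₗ[K] T →ₗ[K] T} {A B C P : Submodule K T} :
    mixedProd t A (B ⊔ C) ≤ P ↔ mixedProd t A B ≤ P ∧ mixedProd t A C ≤ P := by
  simp only [mixedProd_comm t A, mixedProd_le_iff_le_residual, sup_le_iff]

theorem mixedProd_mono {t : T →ₗ[K] T →ₗ[K] T →ₗ[K] T} {A A' B : Submodule K T} (h : A ≤ A') :
    mixedProd t A B ≤ mixedProd t A' B :=
  mixedProd_le_iff_le_residual.2 (h.trans (mixedProd_le_iff_le_residual.1 le_rfl))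

theorem IsIdealT.mixedProd_le {t : T →ₗ[K] T →ₗ[K] T →ₗ[K] T} {A : Submodule K T}
    (hA : IsIdealT t A) (B : Submodule K T) : mixedProd t A B ≤ A :=
  _root_.mixedProd_le.2 fun a ha b _ c =>
    ⟨(hA a ha b c).1, (hA a ha c b).1, (hA a ha b c).2.1, (hA a ha b c).2.2, (hA a ha c b).2.2,
      (hA a ha c b).2.1⟩

theorem IsIdealT.mixedProd {t : T →ₗ[K] T →ₗ[K] T →ₗ[K] T} (h1 : LTS1 t) (h2 : LTS2 t)
    {A B : Submodule K T} (hA : IsIdealT t A) (hB : IsIdealT t B) :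
    IsIdealT t (mixedProd t A B) := by
  set N := _root_.mixedProd t A B
  have hAB : ∀ a ∈ A, ∀ b ∈ B, ∀ c, AllProdMem t N a b c := fun a ha b hb c =>
    allProdMem_mixedProd t ha hb c
  have outer_last : ∀ p q r d e : T, (∀ x y, AllProdMem t N (t p q x) r y) →
      t p q (t r d e) ∈ N → t (t p q r) d e ∈ N := by
    intro p q r d e h h'
    have key := h2 p q r d e
    have : t (t p q r) d e = t p q (t r d e) + t (t p q d) r e + t (t p q e) r d
        - t (t p q e) d r := by rw [key]; abel
    rw [this]
    exact N.sub_mem (N.add_mem (N.add_mem h' (h d e).1) (h e d).1) (h e d).2.1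
  have outer_mid : ∀ p q r d e : T, (∀ x y z, t (t p x q) y z ∈ N) →
      (∀ x, AllProdMem t N (t p d r) q x) → t p (t q r d) e ∈ N → t (t p q r) d e ∈ N := by
    intro p q r d e h h' h''
    have key := h1 p q r d e
    have : t (t p q r) d e = t p (t q r d) e + t (t p r q) d e + t (t p d q) r e
        - t (t p d r) q e := by rw [key]; abel
    rw [this]
    exact N.sub_mem (N.add_mem (N.add_mem h'' (h _ _ _)) (h _ _ _)) (h' e).1
  have swap : ∀ {a b c : T}, AllProdMem t N a b c → AllProdMem t N b a c := fun h =>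
    ⟨h.2.2.1, h.2.2.2.1, h.1, h.2.1, h.2.2.2.2.2, h.2.2.2.2.1⟩
  have left : ∀ a ∈ A, ∀ b ∈ B, ∀ c d e, t (t a c b) d e ∈ N ∧ t (t b c a) d e ∈ N ∧
      t (t c a b) d e ∈ N ∧ t (t c b a) d e ∈ N := by
    intro a ha b hb c d e
    refine ⟨outer_last _ _ _ _ _ ?_ ?_, outer_last _ _ _ _ _ ?_ ?_, outer_last _ _ _ _ _ ?_ ?_,
      outer_last _ _ _ _ _ ?_ ?_⟩
    · exact fun x y => hAB _ (hA a ha c x).1 _ hb y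
    · exact (hAB a ha _ (hB b hb d e).1 c).2.1
    · exact fun x y => swap (hAB _ ha _ (hB b hb c x).1 y)
    · exact (hAB _ (hA a ha d e).1 b hb c).2.2.2.1
    · exact fun x y => hAB _ (hA a ha c x).2.1 _ hb y
    · exact (hAB a ha _ (hB b hb d e).1 c).2.2.2.2.2
    · exact fun x y => swap (hAB _ ha _ (hB b hb c x).2.1 y)
    · exact (hAB _ (hA a ha d e).1 b hb c).2.2.2.2.1
  have left_all : ∀ a ∈ A, ∀ b ∈ B, ∀ c, ∀ d e, t (t a b c) d e ∈ N ∧ t (t b a c) d e ∈ N := by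
    intro a ha b hb c d e
    refine ⟨outer_mid _ _ _ _ _ (fun x y z => (left a ha b hb x y z).1) ?_ ?_,
      outer_mid _ _ _ _ _ (fun x y z => (left a ha b hb x y z).2.1) ?_ ?_⟩
    · exact fun x => hAB _ (hA a ha d c).1 _ hb x
    · exact (hAB a ha _ (hB b hb c d).1 e).1
    · exact fun x => swap (hAB _ ha _ (hB b hb d c).1 x)
    · exact (hAB _ (hA a ha c d).1 b hb e).2.2.1
  have right_mul : ∀ d e, N ≤ N.comap ((t.flip d).flip e) := fun d e =>
    _root_.mixedProd_le.2 fun a ha b hb c =>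
      ⟨(left_all a ha b hb c d e).1, (left a ha b hb c d e).1, (left_all a ha b hb c d e).2,
        (left a ha b hb c d e).2.1, (left a ha b hb c d e).2.2.2, (left a ha b hb c d e).2.2.1⟩
  have combine : ∀ {w x y z : T}, w ∈ N → x ∈ N → y ∈ N → z ∈ N → w - x - y + z ∈ N :=
    fun hw hx hy hz => N.add_mem (N.sub_mem (N.sub_mem hw hx) hy) hz
  have mid_mul : ∀ d e, N ≤ N.comap ((t d).flip e) := by
    refine fun d e => _root_.mixedProd_le.2 fun a ha b hb c => ?_
    have hab : t (t d a b) c e ∈ N := (left a ha b hb d c e).2.2.1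
    have hba : t (t d b a) c e ∈ N := (left a ha b hb d c e).2.2.2
    have hac : t (t d a c) b e ∈ N := (hAB _ (hA a ha d c).2.1 b hb e).1
    have hca : t (t d c a) b e ∈ N := (hAB _ (hA a ha d c).2.2 b hb e).1
    have hbc : t (t d b c) a e ∈ N := (hAB a ha _ (hB b hb d c).2.1 e).2.2.1
    have hcb : t (t d c b) a e ∈ N := (hAB a ha _ (hB b hb d c).2.2 e).2.2.1
    simp only [AllProdMem, Submodule.mem_comap, LinearMap.flip_apply, h1 d]
    refine ⟨?_, ?_, ?_, ?_, ?_, ?_⟩ <;> apply combine <;> assumption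
  have left_mul : ∀ d e, N ≤ N.comap (t d e) := by
    refine fun d e => _root_.mixedProd_le.2 fun a ha b hb c => ?_
    obtain ⟨a₁, a₂, -⟩ := hAB _ (hA a ha d e).2.2 b hb c
    obtain ⟨-, -, b₁, b₂, -⟩ := hAB a ha _ (hB b hb d e).2.2 c
    obtain ⟨-, -, -, -, c₁, c₂⟩ := hAB a ha b hb (t d e c)
    simp only [AllProdMem, Submodule.mem_comap, h2 d]
    refine ⟨?_, ?_, ?_, ?_, ?_, ?_⟩ <;> apply combine <;> assumption
  exact fun x hx d e => ⟨right_mul d e hx, mid_mul d e hx, left_mul d e hx⟩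

theorem isIdealT_clsT {t : T →ₗ[K] T →ₗ[K] T →ₗ[K] T} (h1 : LTS1 t) (h2 : LTS2 t)
    {I : Submodule K T} (hI : IsIdealT t I) : ∀ n, IsIdealT t (clsT t I n)
  | 0 => hI
  | n + 1 => (isIdealT_clsT h1 h2 hI n).mixedProd h1 h2 hI

/-- For ideals `I`, `J` of `T` and every `n ≥ 1`,
`(I + J)ⁿ ⊆ Iⁿ + Jⁿ + Σ_{k=0}^{n−1} (Iᵏ ∩ J^{n−1−k})`. -/
theorem central_lower_sequence_of_sum
    (t : T →ₗ[K] T →ₗ[K] T →ₗ[K] T) (h1 : LTS1 t) (h2 : LTS2 t)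
    (I J : Submodule K T) (hI : IsIdealT t I) (hJ : IsIdealT t J) :
    ∀ n : ℕ, 1 ≤ n →
      clsT t (I ⊔ J) n ≤
        clsT t I n ⊔ clsT t J n ⊔
          ⨆ k ∈ Finset.range n, (clsT t I k ⊓ clsT t J (n - 1 - k)) := by
  have hIn := isIdealT_clsT h1 h2 hI
  have hJn := isIdealT_clsT h1 h2 hJ
  suffices H : ∀ n : ℕ, clsT t (I ⊔ J) n ≤ clsT t I n ⊔ clsT t J n ⊔
      ⨆ k ∈ Finset.range n, (clsT t I k ⊓ clsT t J (n - 1 - k)) from fun n _ => H n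
  intro n
  induction n with
  | zero => exact le_sup_left
  | succ n ih =>
    set P := clsT t I (n + 1) ⊔ clsT t J (n + 1) ⊔
      ⨆ k ∈ Finset.range (n + 1), (clsT t I k ⊓ clsT t J (n + 1 - 1 - k))
    have hmem : ∀ k l, k + l = n → clsT t I k ⊓ clsT t J l ≤ P := by
      intro k l hkl
      obtain rfl : l = n + 1 - 1 - k := by omega
      exact le_sup_of_le_right (le_iSup₂_of_le k (Finset.mem_range.2 (by omega)) le_rfl)
    have hbase : mixedProd t (clsT t I n ⊔ clsT t J n ⊔
        ⨆ k ∈ Finset.range n, (clsT t I k ⊓ clsT t J (n - 1 - k))) (I ⊔ J) ≤ P := by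
      rw [mixedProd_le_iff_le_residual, sup_le_iff, sup_le_iff, iSup₂_le_iff]
      simp only [← mixedProd_le_iff_le_residual, mixedProd_sup_le]
      refine ⟨⟨⟨?_, ?_⟩, ?_, ?_⟩, fun k hk => ⟨?_, ?_⟩⟩
      · exact le_sup_of_le_left le_sup_left
      · refine le_trans (le_inf ((hIn n).mixedProd_le J) ?_) (hmem n 0 rfl)
        rw [mixedProd_comm]
        exact hJ.mixedProd_le _
      · refine le_trans (le_inf ?_ ((hJn n).mixedProd_le I)) (hmem 0 n (zero_add n))
        rw [mixedProd_comm]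
        exact hI.mixedProd_le _
      · exact le_sup_of_le_left le_sup_right
      · have hk := Finset.mem_range.1 hk
        exact le_trans (le_inf (mixedProd_mono (A' := clsT t I k) inf_le_left)
          ((mixedProd_mono inf_le_right).trans ((hJn _).mixedProd_le I)))
          (hmem (k + 1) (n - 1 - k) (by omega))
      · have hk := Finset.mem_range.1 hk
        exact le_trans (le_inf ((mixedProd_mono inf_le_left).trans ((hIn _).mixedProd_le J))
          (mixedProd_mono (A' := clsT t J (n - 1 - k)) inf_le_right))
          (hmem k (n - 1 - k + 1) (by omega))
    exact (mixedProd_mono ih).trans hbase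

end
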